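/- Let d ≥ 3 and f ∈ 𝒮(ℝ^d; ℂ). For every 0 < r < R, the map u ↦ F^(0)(u) is Lipschitz on the compact annulus C(r,R) = {x ∈ ℝ^d : r ≤ |x| ≤ R}, i.e. there exists L' > 0 such that |F^(0)(u) − F^(0)(v)| ≤ L' |u − v| for all u, v ∈ C(r,R). -/

import Mathlib

open MeasureTheory Filter Set
open scoped RealInnerProductSpace Topology ENNReal

noncomputable section

abbrev E (d : ℕ) := EuclideanSpace ℝ (Fin d)

/-- `g(η) = η |f(η)|²`. -/
def gfun {d : ℕ} (f : SchwartzMap (E d) ℂ) (η : E d) : E d := ‖f η‖ ^ 2 • η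

/-- the average `⨍_a^b u(σ) dσ`. -/
def intAvg {d : ℕ} (u : ℝ → E d) (a b : ℝ) : E d := (b - a)⁻¹ • ∫ σ in a..b, u σ

/-- `𝓕^(h)(u)(t)`; since `g` is real-valued, taking the real part of the complex
integral amounts to replacing `e^{-irθ}` by `cos (rθ)`. -/
def calF {d : ℕ} (f : SchwartzMap (E d) ℂ) (h : ℝ) (u : ℝ → E d) (t : ℝ) : E d :=
  (-2 : ℝ) • ∫ η, (∫ r in (0:ℝ)..(t / h),
    Real.cos (r * (‖η‖ ^ 2 - 2 * ⟪η, intAvg u (t - h * r) t⟫))) • gfun f η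

/-- the `i`-th component of the Fourier transform `ĝ(x) = (2π)^{-d/2} ∫ e^{-ix·η} g(η) dη`. -/
def ftGi {d : ℕ} (f : SchwartzMap (E d) ℂ) (i : Fin d) (x : E d) : ℂ :=
  ((2 * Real.pi) ^ (-(d : ℝ) / 2) : ℝ) *
    ∫ η, Complex.exp (-Complex.I * (⟪x, η⟫ : ℝ)) * ((gfun f η i : ℝ) : ℂ)

/-- `‖g‖_{L¹}`. -/
def L1g {d : ℕ} (f : SchwartzMap (E d) ℂ) : ℝ := ∫ η, ‖gfun f η‖

/-- `‖ĝ‖_{L¹}` (with the euclidean norm of the complex vector `ĝ(x)`). -/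
def L1ftg {d : ℕ} (f : SchwartzMap (E d) ℂ) : ℝ :=
  ∫ x, Real.sqrt (∑ i, ‖ftGi f i x‖ ^ 2)

/-- `C_g^1 = ‖g‖_{L¹} + (d/2 − 1) π^{d/2} ‖ĝ‖_{L¹}`. -/
def Cg1 {d : ℕ} (f : SchwartzMap (E d) ℂ) : ℝ :=
  L1g f + ((d : ℝ) / 2 - 1) * Real.pi ^ ((d : ℝ) / 2) * L1ftg f

/-- the inner integral `∫_{ℝ^d} e^{-ir(|η|²-2η·u)} g(η) dη` (the real part being taken
componentwise, `e^{-irθ}` contributes `cos (rθ)` since `g` is real). -/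
def F0inner {d : ℕ} (f : SchwartzMap (E d) ℂ) (r : ℝ) (u : E d) : E d :=
  ∫ η, Real.cos (r * (‖η‖ ^ 2 - 2 * ⟪η, u⟫)) • gfun f η

/-- `F^(0)(u) = −2 Re ∫_0^∞ (∫ e^{−ir(|η|²−2η·u)} η |f(η)|² dη) dr`, as the improper
integral in `r` (i.e. the limit of the integrals over `[0,R]` as `R → ∞`). -/
def F0pt {d : ℕ} (f : SchwartzMap (E d) ℂ) (u : E d) : E d :=
  limUnder atTop fun R : ℝ => ∫ r in (0:ℝ)..R, (-2 : ℝ) • F0inner f r u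

/-- The Dirichlet integral `∫_0^∞ sinc` converges. -/
theorem exists_tendsto_integral_sinc :
    ∃ c : ℝ, Tendsto (fun X : ℝ => ∫ t in (0 : ℝ)..X, Real.sinc t) atTop (𝓝 c) := by
  have hderiv : ∀ x ∈ Ioi (1 : ℝ), HasDerivAt
      (fun X : ℝ => (∫ t in (0 : ℝ)..X, Real.sinc t) + Real.cos X / X)
      (-(Real.cos x / x ^ 2)) x := by
    intro x hx
    have hx0 : x ≠ 0 := (zero_lt_one.trans hx).ne'
    have h1 := intervalIntegral.integral_hasDerivAt_right
      (Real.continuous_sinc.intervalIntegrable 0 x)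
      Real.continuous_sinc.stronglyMeasurable.stronglyMeasurableAtFilter
      Real.continuous_sinc.continuousAt
    refine (h1.add ((Real.hasDerivAt_cos x).div (hasDerivAt_id x) hx0)).congr_deriv ?_
    rw [Real.sinc_of_ne_zero hx0]
    simp only [id]
    field_simp
    ring
  have hint : IntegrableOn (fun x : ℝ => -(Real.cos x / x ^ 2)) (Ioi 1) := by
    refine Integrable.mono' (integrableOn_Ioi_rpow_of_lt (by norm_num : (-2 : ℝ) < -1)
      zero_lt_one) (Measurable.aestronglyMeasurable (by fun_prop)) ?_
    filter_upwards [ae_restrict_mem measurableSet_Ioi] with x hx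
    have hx0 : 0 < x := zero_lt_one.trans hx
    rw [Real.rpow_neg hx0.le, norm_neg, norm_div, norm_pow, Real.norm_of_nonneg hx0.le,
      div_eq_mul_inv]
    norm_cast
    exact mul_le_of_le_one_left (by positivity) (Real.abs_cos_le_one x)
  have hlim := tendsto_limUnder_of_hasDerivAt_of_integrableOn_Ioi hderiv hint
  have hcos : Tendsto (fun X : ℝ => Real.cos X / X) atTop (𝓝 0) := by
    refine squeeze_zero_norm' ?_ tendsto_inv_atTop_zero
    filter_upwards [eventually_gt_atTop 0] with x hx
    rw [norm_div, Real.norm_of_nonneg hx.le, div_eq_mul_inv]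
    exact mul_le_of_le_one_left (by positivity) (Real.abs_cos_le_one x)
  exact ⟨_, (hlim.sub hcos).congr fun x => by ring⟩

/-- Riemann–Lebesgue on the half line for the quadratic phase `s ↦ s² - b`. -/
theorem tendsto_integral_sin_sq_mul (b : ℝ) {Ψ : ℝ → ℝ} (hΨ : IntegrableOn Ψ (Ioi 0)) :
    Tendsto (fun T : ℝ => ∫ s in Ioi (0 : ℝ), Real.sin (T * (s ^ 2 - b)) * Ψ s)
      atTop (𝓝 0) := by
  set F : ℝ → ℂ := (Ioi (0 : ℝ)).indicator fun x =>
    ((1 / 2 : ℝ) * x ^ ((1 / 2 : ℝ) - 1)) • ((Ψ (x ^ (1 / 2 : ℝ)) : ℝ) : ℂ)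
  have hcomp : Tendsto (fun T : ℝ => -T / (2 * Real.pi)) atTop (cocompact ℝ) := by
    refine Tendsto.mono_right ?_ atBot_le_cocompact
    exact (tendsto_neg_atTop_atBot).atBot_div_const (by positivity)
  have hRL := ((Real.tendsto_integral_exp_smul_cocompact F).comp hcomp).norm
  rw [norm_zero] at hRL
  refine squeeze_zero_norm (fun T => ?_) hRL
  have hint : IntegrableOn (fun s : ℝ =>
      Complex.exp ((T * (s ^ 2 - b) : ℝ) * Complex.I) * (Ψ s : ℂ)) (Ioi 0) := by
    refine hΨ.ofReal.bdd_mul (c := 1) (by fun_prop) ?_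
    exact ae_of_all _ fun s => (Complex.norm_exp_ofReal_mul_I _).le
  have him : ∫ s in Ioi (0 : ℝ), Real.sin (T * (s ^ 2 - b)) * Ψ s =
      (∫ s in Ioi (0 : ℝ), Complex.exp ((T * (s ^ 2 - b) : ℝ) * Complex.I) * (Ψ s : ℂ)).im := by
    have := integral_im hint
    simp only [RCLike.im_to_complex] at this
    rw [← this]
    refine integral_congr_ae (ae_of_all _ fun s => ?_)
    simp only [Complex.im_mul_ofReal, Complex.exp_ofReal_mul_I_im]
  have hsub : ∫ s in Ioi (0 : ℝ), Complex.exp ((T * (s ^ 2 - b) : ℝ) * Complex.I) * (Ψ s : ℂ) =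
      Complex.exp ((-(T * b) : ℝ) * Complex.I) *
        ∫ v : ℝ, Real.fourierChar (-(v * (-T / (2 * Real.pi)))) • F v := by
    rw [← integral_comp_rpow_Ioi_of_pos (p := 1 / 2) (by norm_num), ← integral_const_mul,
      ← integral_indicator measurableSet_Ioi]
    refine integral_congr_ae (ae_of_all _ fun x => ?_)
    by_cases hx : x ∈ Ioi (0 : ℝ)
    · have hx2 : (x ^ (1 / 2 : ℝ)) ^ 2 = x := by
        rw [← Real.sqrt_eq_rpow, Real.sq_sqrt (le_of_lt hx)]
      simp only [F, indicator_of_mem hx, hx2, Circle.smul_def, Real.fourierChar_apply,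
        Complex.real_smul, smul_eq_mul]
      have hexp : Complex.exp ((T * (x - b) : ℝ) * Complex.I) =
          Complex.exp ((-(T * b) : ℝ) * Complex.I) *
            Complex.exp ((2 * Real.pi * -(x * (-T / (2 * Real.pi))) : ℝ) * Complex.I) := by
        rw [← Complex.exp_add, ← add_mul, ← Complex.ofReal_add]
        congr 3
        have := Real.pi_ne_zero
        field_simp
        ring
      rw [hexp]
      ring
    · simp [F, indicator_of_notMem hx]
  rw [him, hsub]
  refine (Complex.abs_im_le_norm _).trans ?_
  rw [norm_mul, Complex.norm_exp_ofReal_mul_I, one_mul]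
  rfl

/-- Vector-valued version. -/
theorem tendsto_integral_sin_sq_smul {ι : Type*} [Fintype ι] (b : ℝ)
    {Ψ : ℝ → EuclideanSpace ℝ ι} (hΨ : IntegrableOn Ψ (Ioi 0)) :
    Tendsto (fun T : ℝ => ∫ s in Ioi (0 : ℝ), Real.sin (T * (s ^ 2 - b)) • Ψ s)
      atTop (𝓝 0) := by
  have hint : ∀ T : ℝ, IntegrableOn (fun s : ℝ => Real.sin (T * (s ^ 2 - b)) • Ψ s) (Ioi 0) :=
    fun T => Integrable.bdd_smul (f := Ψ) (φ := fun s : ℝ => Real.sin (T * (s ^ 2 - b))) hΨ 1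
      (by fun_prop) (ae_of_all _ fun s => Real.abs_sin_le_one _)
  have hcoord : Tendsto (fun T : ℝ => fun i =>
      (∫ s in Ioi (0 : ℝ), Real.sin (T * (s ^ 2 - b)) • Ψ s) i) atTop (𝓝 fun _ => 0) := by
    refine tendsto_pi_nhds.2 fun i => ?_
    have hi : IntegrableOn (fun s => Ψ s i) (Ioi 0) :=
      (EuclideanSpace.proj (𝕜 := ℝ) i).integrable_comp hΨ
    refine (tendsto_integral_sin_sq_mul b hi).congr fun T => ?_
    exact (EuclideanSpace.proj (𝕜 := ℝ) i).integral_comp_comm (hint T)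
  exact ((PiLp.continuous_toLp 2 fun _ : ι => ℝ).tendsto _).comp hcoord

theorem integral_Ioi_sinc_sq_mul_indicator {a : ℝ} (ha : 0 < a) (T : ℝ) :
    ∫ s in Ioi (0 : ℝ), T * Real.sinc (T * (s ^ 2 - a ^ 2)) *
        (Iic (2 * a)).indicator (fun s => s / a) s =
      (2 * a)⁻¹ * ((∫ t in (0 : ℝ)..T * (3 * a ^ 2), Real.sinc t) +
        ∫ t in (0 : ℝ)..T * a ^ 2, Real.sinc t) := by
  set Si : ℝ → ℝ := fun X => ∫ t in (0 : ℝ)..X, Real.sinc t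
  have hSi : ∀ X, HasDerivAt Si (Real.sinc X) X := fun X =>
    intervalIntegral.integral_hasDerivAt_right (Real.continuous_sinc.intervalIntegrable 0 X)
      Real.continuous_sinc.stronglyMeasurable.stronglyMeasurableAtFilter
      Real.continuous_sinc.continuousAt
  have hodd : ∀ X, Si (-X) = -Si X := by
    intro X
    have := intervalIntegral.integral_comp_neg (a := 0) (b := X) Real.sinc
    simp only [Real.sinc_neg, neg_zero] at this
    simp only [Si]
    rw [this, intervalIntegral.integral_symm]
  have hcont := Real.continuous_sinc
  have hind : ∀ s : ℝ, T * Real.sinc (T * (s ^ 2 - a ^ 2)) *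
      (Iic (2 * a)).indicator (fun s => s / a) s =
      (Iic (2 * a)).indicator (fun s => T * Real.sinc (T * (s ^ 2 - a ^ 2)) * (s / a)) s := by
    intro s
    by_cases hs : s ∈ Iic (2 * a) <;> simp [indicator, hs]
  simp_rw [hind]
  rw [setIntegral_indicator measurableSet_Iic, Ioi_inter_Iic,
    ← intervalIntegral.integral_of_le (by positivity)]
  have hder : ∀ s ∈ uIcc 0 (2 * a), HasDerivAt
      (fun s => (2 * a)⁻¹ * Si (T * (s ^ 2 - a ^ 2)))
      (T * Real.sinc (T * (s ^ 2 - a ^ 2)) * (s / a)) s := by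
    intro s _
    have h1 : HasDerivAt (fun s : ℝ => T * (s ^ 2 - a ^ 2)) (T * (2 * s)) s := by
      simpa using (((hasDerivAt_id s).pow 2).sub_const (a ^ 2)).const_mul T
    refine (((hSi _).comp s h1).const_mul (2 * a)⁻¹).congr_deriv ?_
    field_simp
  rw [intervalIntegral.integral_eq_sub_of_hasDerivAt hder
    (Continuous.intervalIntegrable (by fun_prop) _ _), ← mul_sub]
  rw [show T * ((2 * a) ^ 2 - a ^ 2) = T * (3 * a ^ 2) by ring,
    show T * ((0 : ℝ) ^ 2 - a ^ 2) = -(T * a ^ 2) by ring, hodd, sub_neg_eq_add]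

/-- Dirichlet's pointwise convergence argument in the variable `s²`: the kernels
`s ↦ T sinc (T (s² - a²))` concentrate at `s = a` as `T → ∞`. -/
theorem tendsto_integral_sinc_sq_smul {c : ℝ}
    (hc : Tendsto (fun X : ℝ => ∫ t in (0 : ℝ)..X, Real.sinc t) atTop (𝓝 c))
    {ι : Type*} [Fintype ι] {φ : ℝ → EuclideanSpace ℝ ι} (hφ : IntegrableOn φ (Ioi 0))
    {a C : ℝ} (ha : 0 < a) (hC : ∀ s ∈ Ioc 0 (2 * a), ‖φ s - φ a‖ ≤ C * |s - a|) :
    Tendsto (fun T : ℝ => ∫ s in Ioi (0 : ℝ), (T * Real.sinc (T * (s ^ 2 - a ^ 2))) • φ s)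
      atTop (𝓝 ((c / a) • φ a)) := by
  set k : ℝ → ℝ := (Iic (2 * a)).indicator fun s => s / a
  have hkm : Measurable k := (by fun_prop : Measurable fun s : ℝ => s / a).indicator
    measurableSet_Iic
  set Ψ : ℝ → EuclideanSpace ℝ ι := fun s => (s ^ 2 - a ^ 2)⁻¹ • (φ s - k s • φ a)
  have hΨm : AEStronglyMeasurable Ψ (volume.restrict (Ioi 0)) :=
    (by fun_prop : Measurable fun s : ℝ => (s ^ 2 - a ^ 2)⁻¹).aestronglyMeasurable.smul
      (hφ.1.sub (hkm.aestronglyMeasurable.smul aestronglyMeasurable_const))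
  have hunion : Ioc 0 (2 * a) ∪ Ioi (2 * a) = Ioi (0 : ℝ) :=
    Ioc_union_Ioi_eq_Ioi (by positivity)
  have hΨ : IntegrableOn Ψ (Ioi 0) := by
    rw [← hunion] at hφ hΨm ⊢
    refine IntegrableOn.union ?_ ?_
    · refine Integrable.mono' (integrable_const ((C + ‖φ a‖ / a) / a))
        (hΨm.mono_set subset_union_left) ?_
      filter_upwards [ae_restrict_mem measurableSet_Ioc] with s hs
      have hk : k s = s / a := indicator_of_mem (mem_Iic.2 hs.2) _
      have hs0 : 0 < s := hs.1
      rcases eq_or_ne s a with rfl | hsa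
      · have := (norm_nonneg _).trans (hC (2 * s) ⟨by positivity, le_rfl⟩)
        have hs' : |2 * s - s| = s := by rw [abs_of_pos] <;> linarith
        rw [hs'] at this
        have hC0 : 0 ≤ C := nonneg_of_mul_nonneg_left this hs0
        simp only [Ψ, sub_self, inv_zero, zero_smul, norm_zero]
        positivity
      · have habs : 0 < |s - a| := abs_pos.2 (sub_ne_zero.2 hsa)
        have hnum : ‖φ s - k s • φ a‖ ≤ (C + ‖φ a‖ / a) * |s - a| := by
          have : φ s - k s • φ a = (φ s - φ a) - ((s - a) / a) • φ a := by
            rw [hk, sub_div, div_self ha.ne', sub_smul, one_smul]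
            abel
          rw [this]
          refine (norm_sub_le _ _).trans ?_
          rw [norm_smul, Real.norm_eq_abs, abs_div, abs_of_pos ha]
          calc ‖φ s - φ a‖ + |s - a| / a * ‖φ a‖
              ≤ C * |s - a| + |s - a| / a * ‖φ a‖ := by gcongr; exact hC s hs
            _ = _ := by ring
        have hden : ‖s ^ 2 - a ^ 2‖ = (s + a) * |s - a| := by
          rw [sq_sub_sq, norm_mul, Real.norm_eq_abs, Real.norm_eq_abs, abs_of_pos (by positivity)]
        have hK : 0 ≤ C + ‖φ a‖ / a :=
          nonneg_of_mul_nonneg_left ((norm_nonneg _).trans hnum) habs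
        rw [norm_smul, norm_inv, hden, inv_mul_le_iff₀ (by positivity)]
        refine hnum.trans ?_
        rw [mul_right_comm]
        gcongr
        rw [← mul_div_assoc, le_div_iff₀ ha, mul_comm]
        gcongr
        linarith
    · refine Integrable.mono' ((hφ.mono_set subset_union_right).norm.const_mul (3 * a ^ 2)⁻¹)
        (hΨm.mono_set subset_union_right) ?_
      filter_upwards [ae_restrict_mem measurableSet_Ioi] with s hs
      have hs' : 2 * a < s := hs
      have hk : k s = 0 := indicator_of_notMem (by simpa using hs') _
      have hge : 3 * a ^ 2 ≤ s ^ 2 - a ^ 2 := by nlinarith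
      have hpos : 0 < 3 * a ^ 2 := by positivity
      simp only [Ψ]
      rw [hk, zero_smul, sub_zero, norm_smul, norm_inv, Real.norm_of_nonneg (hpos.le.trans hge)]
      gcongr
  have hSi : Tendsto (fun T : ℝ => (∫ s in Ioi (0 : ℝ), Real.sin (T * (s ^ 2 - a ^ 2)) • Ψ s) +
      ((2 * a)⁻¹ * ((∫ t in (0 : ℝ)..T * (3 * a ^ 2), Real.sinc t) +
        ∫ t in (0 : ℝ)..T * a ^ 2, Real.sinc t)) • φ a) atTop (𝓝 ((c / a) • φ a)) := by
    have h1 := hc.comp (tendsto_id.atTop_mul_const (by positivity : 0 < 3 * a ^ 2))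
    have h2 := hc.comp (tendsto_id.atTop_mul_const (by positivity : 0 < a ^ 2))
    have h3 := (tendsto_integral_sin_sq_smul (a ^ 2) hΨ).add
      (((h1.add h2).const_mul (2 * a)⁻¹).smul_const (φ a))
    rw [zero_add, show (2 * a)⁻¹ * (c + c) = c / a by field_simp; ring] at h3
    exact h3
  refine hSi.congr' ?_
  filter_upwards [eventually_gt_atTop 0] with T hT
  rw [← integral_Ioi_sinc_sq_mul_indicator ha, ← integral_smul_const, ← integral_add]
  · have hne : ∀ᵐ s ∂volume.restrict (Ioi (0 : ℝ)), s ≠ a :=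
      ae_restrict_of_ae (Measure.ae_ne volume a)
    refine integral_congr_ae ?_
    filter_upwards [hne, ae_restrict_mem measurableSet_Ioi] with s hsa hs
    have hs0 : 0 < s := hs
    have hθ : s ^ 2 - a ^ 2 ≠ 0 := by
      rw [sq_sub_sq]
      exact mul_ne_zero (by positivity) (sub_ne_zero.2 hsa)
    have hsinc : T * Real.sinc (T * (s ^ 2 - a ^ 2)) =
        Real.sin (T * (s ^ 2 - a ^ 2)) * (s ^ 2 - a ^ 2)⁻¹ := by
      rw [Real.sinc_of_ne_zero (mul_ne_zero hT.ne' hθ)]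
      field_simp
    change _ + (T * Real.sinc (T * (s ^ 2 - a ^ 2)) * k s) • φ a = _
    simp only [Ψ]
    rw [hsinc]
    module
  · exact Integrable.bdd_smul (f := Ψ) (φ := fun s : ℝ => Real.sin (T * (s ^ 2 - a ^ 2))) hΨ 1
      (by fun_prop) (ae_of_all _ fun s => Real.abs_sin_le_one _)
  · refine Integrable.smul_const ?_ (φ a)
    have hkint : IntegrableOn k (Ioi 0) := by
      rw [IntegrableOn, integrable_indicator_iff measurableSet_Iic, IntegrableOn,
        Measure.restrict_restrict measurableSet_Iic, inter_comm, Ioi_inter_Iic]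
      exact (by fun_prop : Continuous fun s : ℝ => s / a).integrableOn_Ioc
    have := Real.continuous_sinc
    refine hkint.bdd_mul (c := T) (by fun_prop) (ae_of_all _ fun s => ?_)
    rw [norm_mul, Real.norm_of_nonneg hT.le]
    exact mul_le_of_le_one_right hT.le (Real.abs_sinc_le_one _)

section polar
open Module
variable {V F : Type*} [NormedAddCommGroup V] [NormedSpace ℝ V] [MeasurableSpace V] [BorelSpace V]
  [FiniteDimensional ℝ V] [NormedAddCommGroup F]

theorem integrable_toSphere_prod (μ : Measure V) [μ.IsAddHaarMeasure] {h : V → F}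
    (hh : Integrable h μ) :
    Integrable (fun p : Metric.sphere (0 : V) 1 × Ioi (0 : ℝ) => h (p.2.1 • p.1.1))
      (μ.toSphere.prod (.volumeIoiPow (finrank ℝ V - 1))) := by
  rw [← μ.measurePreserving_homeomorphUnitSphereProd.integrable_comp_emb
    (Homeomorph.measurableEmbedding _)]
  have h0 : Integrable (fun x : ({0}ᶜ : Set V) => h x) (μ.comap (↑)) := by
    have := hh.integrableOn (s := ({0}ᶜ : Set V))
    rwa [integrableOn_iff_comap_subtypeVal (measurableSet_singleton _).compl] at this
  refine h0.congr (ae_of_all _ fun x => ?_)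
  have hx : ‖x.1‖ ≠ 0 := norm_ne_zero_iff.2 x.2
  simp [smul_smul, mul_inv_cancel₀ hx]

variable [NormedSpace ℝ F]

theorem integrable_volumeIoiPow_iff (n : ℕ) {k : ℝ → F} :
    Integrable (fun s : Ioi (0 : ℝ) => k s) (.volumeIoiPow n) ↔
      IntegrableOn (fun s => s ^ n • k s) (Ioi 0) := by
  rw [integrableOn_iff_comap_subtypeVal measurableSet_Ioi, Measure.volumeIoiPow,
    integrable_withDensity_iff_integrable_smul' (by fun_prop) (by simp)]
  refine integrable_congr (.of_forall ?_)
  rintro ⟨x, hx : 0 < x⟩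
  simp (disch := positivity) [ENNReal.toReal_ofReal]

theorem integral_volumeIoiPow (n : ℕ) (k : ℝ → F) :
    ∫ s : Ioi (0 : ℝ), k s ∂(.volumeIoiPow n) = ∫ s in Ioi (0 : ℝ), s ^ n • k s := by
  simp only [Measure.volumeIoiPow, ENNReal.ofReal]
  rw [integral_withDensity_eq_integral_smul (by fun_prop),
    integral_subtype_comap measurableSet_Ioi fun a ↦ Real.toNNReal (a ^ n) • k a,
    setIntegral_congr_fun measurableSet_Ioi fun x hx ↦ ?_]
  rw [NNReal.smul_def, Real.coe_toNNReal _ (pow_nonneg (le_of_lt hx) _)]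

/-- The radial density of an integrable function is integrable. -/
theorem integrableOn_pow_smul_integral_sphere (μ : Measure V) [μ.IsAddHaarMeasure] {h : V → F}
    (hh : Integrable h μ) :
    IntegrableOn (fun s : ℝ => s ^ (finrank ℝ V - 1) •
      ∫ ω : Metric.sphere (0 : V) 1, h (s • ω.1) ∂μ.toSphere) (Ioi 0) := by
  rw [← integrable_volumeIoiPow_iff]
  exact (integrable_toSphere_prod μ hh).integral_prod_right

/-- Integration in polar coordinates. -/
theorem integral_eq_integral_pow_smul_integral_sphere [Nontrivial V] (μ : Measure V)
    [μ.IsAddHaarMeasure] {h : V → F} (hh : Integrable h μ) :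
    ∫ x, h x ∂μ = ∫ s in Ioi (0 : ℝ), s ^ (finrank ℝ V - 1) •
      ∫ ω : Metric.sphere (0 : V) 1, h (s • ω.1) ∂μ.toSphere := by
  rw [← integral_volumeIoiPow (finrank ℝ V - 1)
    fun s => ∫ ω : Metric.sphere (0 : V) 1, h (s • ω.1) ∂μ.toSphere,
    ← integral_prod_symm _ (integrable_toSphere_prod μ hh),
    ← μ.measurePreserving_homeomorphUnitSphereProd.integral_comp
      (Homeomorph.measurableEmbedding _)]
  nth_rw 1 [← restrict_compl_singleton (μ := μ) 0]
  rw [← integral_subtype_comap (measurableSet_singleton _).compl]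
  refine integral_congr_ae (ae_of_all _ fun x => ?_)
  have hx : ‖x.1‖ ≠ 0 := norm_ne_zero_iff.2 x.2
  simp [smul_smul, mul_inv_cancel₀ hx]
end polar

theorem exists_lipschitz_pow_smul_integral_sphere {V F : Type*} [NormedAddCommGroup V]
    [NormedSpace ℝ V] [FiniteDimensional ℝ V] [MeasurableSpace V] [BorelSpace V]
    [NormedAddCommGroup F] [NormedSpace ℝ F] (σ : Measure (Metric.sphere (0 : V) 1))
    [IsFiniteMeasure σ] {g : V → F} (hg : ContDiff ℝ 1 g) (n : ℕ) (ρ : ℝ) :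
    ∃ L : ℝ, 0 ≤ L ∧ ∀ s ∈ Icc 0 ρ, ∀ t ∈ Icc 0 ρ, ∀ u : V, ‖u‖ ≤ ρ → ∀ v : V, ‖v‖ ≤ ρ →
      ‖s ^ n • (∫ ω, g (u + s • ω.1) ∂σ) - t ^ n • (∫ ω, g (v + t • ω.1) ∂σ)‖ ≤
        L * max |s - t| ‖u - v‖ := by
  set G : ℝ × V × V → F := fun p => p.1 ^ n • g (p.2.1 + p.1 • p.2.2)
  have hG : ContDiff ℝ 1 G :=
    (contDiff_fst.pow n).smul (hg.comp (contDiff_snd.fst.add (contDiff_fst.smul contDiff_snd.snd)))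
  have : ProperSpace V := FiniteDimensional.proper ℝ V
  obtain ⟨K, hK⟩ := LocallyLipschitzOn.exists_lipschitzOnWith_of_compact
    (s := Icc 0 ρ ×ˢ Metric.closedBall (0 : V) ρ ×ˢ Metric.closedBall (0 : V) 1)
    (isCompact_Icc.prod ((isCompact_closedBall _ _).prod (isCompact_closedBall _ _)))
    (hG.locallyLipschitz.locallyLipschitzOn)
  have hint : ∀ (s : ℝ) (u : V),
      Integrable (fun ω : Metric.sphere (0 : V) 1 => s ^ n • g (u + s • ω.1)) σ := fun s u => by
    have := hg.continuous
    exact Continuous.integrable_of_hasCompactSupport (by fun_prop)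
      (HasCompactSupport.of_compactSpace _)
  refine ⟨K * σ.real univ, by positivity, fun s hs t ht u hu v hv => ?_⟩
  rw [← integral_smul, ← integral_smul, ← integral_sub (hint s u) (hint t v), mul_right_comm]
  refine norm_integral_le_of_norm_le_const (ae_of_all _ fun ω => ?_)
  have hω : ω.1 ∈ Metric.closedBall (0 : V) 1 := Metric.sphere_subset_closedBall ω.2
  have := hK.dist_le_mul (s, u, ω.1) ⟨hs, by simpa using hu, hω⟩ (t, v, ω.1)
    ⟨ht, by simpa using hv, hω⟩
  simpa [G, dist_eq_norm, Prod.dist_eq] using this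

variable {d : ℕ} (f : SchwartzMap (E d) ℂ)

theorem contDiff_gfun : ContDiff ℝ 1 (gfun f) :=
  ((f.smooth 1).norm_sq ℝ).smul contDiff_id

theorem integrable_gfun : Integrable (gfun f) := by
  obtain ⟨C, -, hC⟩ := f.decay 0 0
  refine Integrable.mono' ((f.integrable_pow_mul volume 1).const_mul C)
    (contDiff_gfun f).continuous.aestronglyMeasurable (ae_of_all _ fun η => ?_)
  have h := hC η
  simp only [pow_zero, one_mul, norm_iteratedFDeriv_zero] at h
  rw [gfun, norm_smul, norm_pow, norm_norm, sq, pow_one, mul_assoc, mul_comm ‖η‖]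
  gcongr

theorem intervalIntegral_cos_mul (T θ : ℝ) :
    ∫ r in (0 : ℝ)..T, Real.cos (r * θ) = T * Real.sinc (T * θ) := by
  rcases eq_or_ne θ 0 with rfl | hθ
  · simp
  rcases eq_or_ne T 0 with rfl | hT
  · simp
  rw [intervalIntegral.integral_comp_mul_right _ hθ, integral_cos,
    Real.sinc_of_ne_zero (mul_ne_zero hT hθ), smul_eq_mul]
  simp
  field_simp

theorem intervalIntegral_F0inner (T : ℝ) (u : E d) :
    ∫ r in (0 : ℝ)..T, F0inner f r u =
      ∫ ξ, (T * Real.sinc (T * (‖ξ‖ ^ 2 - ‖u‖ ^ 2))) • gfun f (u + ξ) := by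
  have hg := integrable_gfun f
  have hgc := (contDiff_gfun f).continuous
  simp only [F0inner]
  rw [intervalIntegral_integral_swap]
  · rw [← integral_add_left_eq_self _ u]
    refine integral_congr_ae (ae_of_all _ fun ξ => ?_)
    have hθ : ‖u + ξ‖ ^ 2 - 2 * ⟪u + ξ, u⟫ = ‖ξ‖ ^ 2 - ‖u‖ ^ 2 := by
      rw [norm_add_sq_real, inner_add_left, real_inner_self_eq_norm_sq, real_inner_comm]
      ring
    simp only [hθ]
    rw [intervalIntegral.integral_smul_const, intervalIntegral_cos_mul]
  · have : IsFiniteMeasure (volume.restrict (uIoc 0 T)) := by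
      rw [uIoc]
      infer_instance
    refine Integrable.mono' (hg.norm.comp_snd _)
      (Continuous.aestronglyMeasurable (by fun_prop)) (ae_of_all _ fun p => ?_)
    rw [Function.uncurry_apply_pair, norm_smul]
    exact mul_le_of_le_one_left (norm_nonneg _) (Real.abs_cos_le_one _)

/-- Up to a universal constant, `F^(0)(u)` is the integral of `g` over the sphere of radius `‖u‖`
around `u`, divided by `‖u‖`. -/
theorem exists_F0pt_eq (hd : 2 ≤ d) : ∃ c : ℝ, ∀ (f : SchwartzMap (E d) ℂ) (u : E d), u ≠ 0 →
    F0pt f u = c • ‖u‖ ^ (d - 2) •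
      ∫ ω : Metric.sphere (0 : E d) 1, gfun f (u + ‖u‖ • ω.1) ∂volume.toSphere := by
  obtain ⟨c, hc⟩ := exists_tendsto_integral_sinc
  refine ⟨-2 * c, fun f u hu => ?_⟩
  have ha : 0 < ‖u‖ := norm_pos_iff.2 hu
  have : Nontrivial (E d) := ⟨⟨u, 0, hu⟩⟩
  set φ : ℝ → E d := fun s => s ^ (d - 1) •
    ∫ ω : Metric.sphere (0 : E d) 1, gfun f (u + s • ω.1) ∂volume.toSphere with hφdef
  have hfin : Module.finrank ℝ (E d) = d := finrank_euclideanSpace_fin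
  have hshift : Integrable fun ξ => gfun f (u + ξ) := (integrable_gfun f).comp_add_left u
  have hφ : IntegrableOn φ (Ioi 0) := by
    simpa only [hfin] using integrableOn_pow_smul_integral_sphere volume hshift
  obtain ⟨L, -, hL⟩ := exists_lipschitz_pow_smul_integral_sphere
    (volume : Measure (E d)).toSphere (contDiff_gfun f) (d - 1) (2 * ‖u‖)
  have hlim := tendsto_integral_sinc_sq_smul hc hφ ha (C := L) fun s hs => by
    have := hL s ⟨hs.1.le, hs.2⟩ ‖u‖ ⟨ha.le, by linarith⟩ u (by linarith) u (by linarith)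
    simpa using this
  have hpolar : ∀ T : ℝ, ∫ r in (0 : ℝ)..T, (-2 : ℝ) • F0inner f r u =
      (-2 : ℝ) • ∫ s in Ioi (0 : ℝ), (T * Real.sinc (T * (s ^ 2 - ‖u‖ ^ 2))) • φ s := by
    intro T
    have hint : Integrable fun ξ : E d =>
        (T * Real.sinc (T * (‖ξ‖ ^ 2 - ‖u‖ ^ 2))) • gfun f (u + ξ) := by
      have := Real.continuous_sinc
      refine Integrable.bdd_smul (f := fun ξ => gfun f (u + ξ))
        (φ := fun ξ : E d => T * Real.sinc (T * (‖ξ‖ ^ 2 - ‖u‖ ^ 2))) hshift |T|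
        (Continuous.aestronglyMeasurable (by fun_prop)) (ae_of_all _ fun ξ => ?_)
      rw [norm_mul]
      exact mul_le_of_le_one_right (abs_nonneg _) (Real.abs_sinc_le_one _)
    rw [intervalIntegral.integral_smul, intervalIntegral_F0inner,
      integral_eq_integral_pow_smul_integral_sphere volume hint, hfin]
    congr 1
    refine setIntegral_congr_fun measurableSet_Ioi fun s hs => ?_
    have hnorm : ∀ ω : Metric.sphere (0 : E d) 1, ‖s • ω.1‖ = s := fun ω => by
      rw [norm_smul, norm_eq_of_mem_sphere, mul_one, Real.norm_of_nonneg (le_of_lt hs)]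
    simp only [hnorm, hφdef]
    rw [integral_smul, smul_comm]
  have hpow : ‖u‖ ^ (d - 1) = ‖u‖ ^ (d - 2) * ‖u‖ := by
    rw [← pow_succ]
    congr 1
    omega
  refine Tendsto.limUnder_eq ?_
  simp only [hpolar]
  convert hlim.const_smul (-2 : ℝ) using 2
  simp only [hφdef, smul_smul, hpow]
  congr 1
  field_simp

/-- for `d ≥ 3`, `f` Schwartz and `0 < r < R`, the map `F^(0)` is Lipschitz on
the annulus `C(r,R) = {x : r ≤ |x| ≤ R}`. -/
theorem statement8 (d : ℕ) (hd : 3 ≤ d) (f : SchwartzMap (E d) ℂ)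
    (r R : ℝ) (hr : 0 < r) (hrR : r < R) :
    ∃ L' : ℝ, 0 < L' ∧ ∀ u ∈ {x : E d | r ≤ ‖x‖ ∧ ‖x‖ ≤ R},
      ∀ v ∈ {x : E d | r ≤ ‖x‖ ∧ ‖x‖ ≤ R},
        ‖F0pt f u - F0pt f v‖ ≤ L' * ‖u - v‖ := by
  obtain ⟨c, hc⟩ := exists_F0pt_eq (d := d) (by omega)
  obtain ⟨L, hL0, hL⟩ := exists_lipschitz_pow_smul_integral_sphere
    (volume : Measure (E d)).toSphere (contDiff_gfun f) (d - 2) R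
  refine ⟨|c| * L + 1, by positivity, fun u hu v hv => ?_⟩
  rw [hc f u (norm_pos_iff.1 (hr.trans_le hu.1)), hc f v (norm_pos_iff.1 (hr.trans_le hv.1)),
    ← smul_sub, norm_smul, Real.norm_eq_abs]
  have h := hL ‖u‖ ⟨norm_nonneg _, hu.2⟩ ‖v‖ ⟨norm_nonneg _, hv.2⟩ u hu.2 v hv.2
  rw [max_eq_right (abs_norm_sub_norm_le u v)] at h
  calc _ ≤ |c| * (L * ‖u - v‖) := by gcongr
    _ ≤ (|c| * L + 1) * ‖u - v‖ := by nlinarith [norm_nonneg (u - v)]
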